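/- There exists a constant C > 0, depending only on s, such that for every h ∈ (0,1), every m > 0 (with a = h^{−m} ≥ 1), and every r > 0 with r ≠ a, one has μ(r)² / μ'(r) ≤ C a⁴ (r+1)^{2s}. -/

import Mathlib

open Real

/-- The weight function `μ` of Section 2 (with parameters `s` and `a = h^{-m}`). -/
noncomputable def muF (s a r : ℝ) : ℝ :=
  if r ≤ a then (r + 1) ^ 2 - 1
  else (a + 1) ^ 2 - 1 + (a + 1) ^ (-(2 * s) + 1) - (r + 1) ^ (-(2 * s) + 1)

/-- The derivative `μ'` of the weight function (away from `r = a`). -/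
noncomputable def muD (s a r : ℝ) : ℝ :=
  if r < a then 2 * (r + 1) else (2 * s - 1) * (r + 1) ^ (-(2 * s))

/-- The derivative `φ'` of the phase function (with parameters `τ` and `a`). -/
noncomputable def phiD (τ a r : ℝ) : ℝ :=
  if r ≤ a then τ * ((r + 1)⁻¹ - (a + 1)⁻¹) else 0

/-- The second derivative `φ''` of the phase function (away from `r = a`). -/
noncomputable def phiDD (τ a r : ℝ) : ℝ :=
  if r < a then -τ * (r + 1) ^ (-(2 : ℝ)) else 0

/-- The phase function `φ(r) = ∫₀^r φ'(t) dt`. -/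
noncomputable def phiF (τ a r : ℝ) : ℝ := ∫ t in (0 : ℝ)..r, phiD τ a t

/-- `A(r) = (μ φ'²)'(r)`. -/
noncomputable def AF (s τ a r : ℝ) : ℝ :=
  deriv (fun t => muF s a t * (phiD τ a t) ^ 2) r

/-- `B(r) = (μ(r)(h^{-1}(r+1)^{-δ} + |φ''(r)|))² / (h^{-1} φ'(r) μ(r) + μ'(r))`. -/
noncomputable def BF (δ s h τ a r : ℝ) : ℝ :=
  (muF s a r * (h⁻¹ * (r + 1) ^ (-δ) + |phiDD τ a r|)) ^ 2 /
    (h⁻¹ * phiD τ a r * muF s a r + muD s a r)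

lemma muF_nonneg {s a r : ℝ} (hs : 1 / 2 < s) (ha : 0 ≤ a) (hr : 0 ≤ r) : 0 ≤ muF s a r := by
  unfold muF
  split_ifs with h
  · nlinarith
  · have := rpow_le_rpow_of_nonpos (show 0 < a + 1 by linarith)
      (show a + 1 ≤ r + 1 by linarith) (show -(2 * s) + 1 ≤ 0 by linarith)
    nlinarith

lemma muF_le {s a r : ℝ} (hs : 1 / 2 < s) (ha : 0 ≤ a) (hr : 0 ≤ r) :
    muF s a r ≤ (a + 1) ^ 2 := by
  unfold muF
  split_ifs with h
  · nlinarith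
  · have h1 := rpow_le_one_of_one_le_of_nonpos (show 1 ≤ a + 1 by linarith)
      (show -(2 * s) + 1 ≤ 0 by linarith)
    have h2 := rpow_nonneg (show 0 ≤ r + 1 by linarith) (-(2 * s) + 1)
    linarith

lemma inv_muD_le {s a r : ℝ} (hs : 1 / 2 < s) (hr : 0 ≤ r) :
    (muD s a r)⁻¹ ≤ (1 / 2 + (2 * s - 1)⁻¹) * (r + 1) ^ (2 * s) := by
  have hpos : 0 < (2 * s - 1)⁻¹ := inv_pos.2 (by linarith)
  have hone : 1 ≤ (r + 1) ^ (2 * s) := one_le_rpow (by linarith) (by linarith)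
  unfold muD
  split_ifs with h
  · have : (2 * (r + 1))⁻¹ ≤ 1 / 2 := by
      rw [one_div]
      exact inv_anti₀ (by norm_num) (by linarith)
    nlinarith
  · rw [mul_inv, rpow_neg (by linarith), inv_inv]
    nlinarith

/-- Lemma 2.1, (2.4). There is `C > 0` depending only on `s` such that
for every `h ∈ (0,1)`, every `m > 0` (so that `a = h^{-m} ≥ 1`) and every `r > 0`, `r ≠ a`:
`μ(r)² / μ'(r) ≤ C a⁴ (r+1)^{2s}`. -/
theorem statement4 (δ s : ℝ) (hδ : 3 < δ) (hs1 : 1 / 2 < s) (hs2 : s < (δ - 2) / 2) :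
    ∃ C > (0 : ℝ), ∀ h m : ℝ, 0 < h → h < 1 → 0 < m →
      ∀ r : ℝ, 0 < r → r ≠ h ^ (-m) →
        (muF s (h ^ (-m)) r) ^ 2 / muD s (h ^ (-m)) r ≤
          C * (h ^ (-m)) ^ 4 * (r + 1) ^ (2 * s) := by
  have hs : 0 < (2 * s - 1)⁻¹ := inv_pos.2 (by linarith)
  refine ⟨16 * (1 / 2 + (2 * s - 1)⁻¹), by positivity, fun h m h0 h1 hm r hr _ => ?_⟩
  have ha : 1 ≤ h ^ (-m) := one_le_rpow_of_pos_of_le_one_of_nonpos h0 h1.le (by linarith)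
  generalize h ^ (-m) = a at ha ⊢
  have hμ : muF s a r ≤ 4 * a ^ 2 :=
    (muF_le hs1 (by linarith) hr.le).trans (by nlinarith)
  calc muF s a r ^ 2 / muD s a r
      = muF s a r ^ 2 * (muD s a r)⁻¹ := div_eq_mul_inv _ _
    _ ≤ muF s a r ^ 2 * ((1 / 2 + (2 * s - 1)⁻¹) * (r + 1) ^ (2 * s)) := by
        gcongr
        exact inv_muD_le hs1 hr.le
    _ ≤ (4 * a ^ 2) ^ 2 * ((1 / 2 + (2 * s - 1)⁻¹) * (r + 1) ^ (2 * s)) := by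
        have := muF_nonneg hs1 (show 0 ≤ a by linarith) hr.le
        gcongr
    _ = 16 * (1 / 2 + (2 * s - 1)⁻¹) * a ^ 4 * (r + 1) ^ (2 * s) := by ring
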